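/- arXiv:1708.06058 — 2 statements merged into one kernel-verified Lean document; each statement's English description precedes it below -/
import Mathlib

section
/- Let m, n, t be positive integers with t ≥ 2, and let D be a defining set of the full (m,n,t)-balanced rectangle F_{m,n,t}. For each cell (i,j) let e_{i,j} denote the number of symbols (counted with multiplicity) in cell (i,j) of D. Then Σ_{i=1}^{m} Σ_{j=1}^{n} (t − e_{i,j})(t − e_{i,j} − 1)/2 ≤ t(t−1)(m+n−1)/2. -/
/-- An `(m,n,t)`-balanced rectangle: an `m × n` array of multisets of elements of `{1,…,t}`,
each cell of size `t`, with each symbol occurring exactly `n` times in each row and exactly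
`m` times in each column. -/
def IsBalancedRect (m n t : ℕ) (L : Fin m → Fin n → Multiset (Fin t)) : Prop :=
  (∀ i j, (L i j).card = t) ∧
  (∀ (i : Fin m) (s : Fin t), ∑ j, (L i j).count s = n) ∧
  (∀ (j : Fin n) (s : Fin t), ∑ i, (L i j).count s = m)

/-- A partial `(m,n,t)`-balanced rectangle: cells of size at most `t`, each symbol
occurring at most `n` times per row and at most `m` times per column. -/
def IsPartialRect (m n t : ℕ) (D : Fin m → Fin n → Multiset (Fin t)) : Prop :=
  (∀ i j, (D i j).card ≤ t) ∧
  (∀ (i : Fin m) (s : Fin t), ∑ j, (D i j).count s ≤ n) ∧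
  (∀ (j : Fin n) (s : Fin t), ∑ i, (D i j).count s ≤ m)

/-- The full `(m,n,t)`-balanced rectangle: each cell is the set `{1,…,t}`. -/
def fullRect (m n t : ℕ) : Fin m → Fin n → Multiset (Fin t) :=
  fun _ _ => (Finset.univ : Finset (Fin t)).val

/-- `D` is a defining set of the full `(m,n,t)`-balanced rectangle: `D` is a partial
balanced rectangle contained in the full rectangle, and the full rectangle is the unique
balanced rectangle to which `D` completes. -/
def IsDefiningSetRect (m n t : ℕ) (D : Fin m → Fin n → Multiset (Fin t)) : Prop :=
  IsPartialRect m n t D ∧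
  (∀ i j, D i j ≤ fullRect m n t i j) ∧
  ∀ L : Fin m → Fin n → Multiset (Fin t),
    IsBalancedRect m n t L → (∀ i j, D i j ≤ L i j) → L = fullRect m n t


lemma exists_periodic {R : Type*} [Finite R] [Nonempty R] (g : R → R) :
    (Function.periodicPts g).Nonempty := by
  obtain ⟨x⟩ := ‹Nonempty R›
  obtain ⟨a, b, hab, h⟩ := Finite.exists_ne_map_eq_of_infinite (fun k : ℕ => g^[k] x)
  wlog hlt : a < b generalizing a b
  · exact this b a hab.symm h.symm (by omega)
  refine ⟨g^[a] x, b - a, by omega, ?_⟩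
  unfold Function.IsPeriodicPt Function.IsFixedPt
  rw [← Function.iterate_add_apply, Nat.sub_add_cancel hlt.le, h]

lemma exists_kernel (m n : ℕ) (hm : 0 < m) (E : Finset (Fin m × Fin n))
    (hE : m + n - 1 < E.card) :
    ∃ f : Fin m → Fin n → ℚ, (∀ i, ∑ j, f i j = 0) ∧ (∀ j, ∑ i, f i j = 0) ∧
      (∀ i j, f i j ≠ 0 → (i, j) ∈ E) ∧ ∃ i j, f i j ≠ 0 := by
  classical
  obtain ⟨k, rfl⟩ : ∃ k, m = k + 1 := ⟨m - 1, by omega⟩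
  let F : (E → ℚ) → Fin (k+1) → Fin n → ℚ := fun x i j => if h : (i, j) ∈ E then x ⟨(i, j), h⟩ else 0
  let T : (E → ℚ) →ₗ[ℚ] (Fin k → ℚ) × (Fin n → ℚ) :=
    { toFun := fun x => (fun i => ∑ j, F x i.succ j, fun j => ∑ i, F x i j)
      map_add' := by
        intro x y
        ext i
        · simp only [F, Prod.fst_add, Pi.add_apply, ← Finset.sum_add_distrib]
          refine Finset.sum_congr rfl fun j _ => ?_
          split_ifs <;> simp
        · simp only [F, Prod.snd_add, Pi.add_apply, ← Finset.sum_add_distrib]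
          refine Finset.sum_congr rfl fun j _ => ?_
          split_ifs <;> simp
      map_smul' := by
        intro c x
        ext i
        · simp only [F, Prod.smul_fst, Pi.smul_apply, Finset.smul_sum, RingHom.id_apply]
          refine Finset.sum_congr rfl fun j _ => ?_
          split_ifs <;> simp
        · simp only [F, Prod.smul_snd, Pi.smul_apply, Finset.smul_sum, RingHom.id_apply]
          refine Finset.sum_congr rfl fun j _ => ?_
          split_ifs <;> simp }
  have hker : LinearMap.ker T ≠ ⊥ := by
    apply LinearMap.ker_ne_bot_of_finrank_lt
    simp
    omega
  obtain ⟨x, hx, hx0⟩ := (Submodule.ne_bot_iff _).1 hker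
  have hT : T x = 0 := hx
  have h1 : ∀ i : Fin k, ∑ j, F x i.succ j = 0 := fun i => congrFun (congrArg Prod.fst hT) i
  have h2 : ∀ j, ∑ i, F x i j = 0 := fun j => congrFun (congrArg Prod.snd hT) j
  refine ⟨F x, ?_, h2, ?_, ?_⟩
  · intro i
    refine Fin.cases ?_ h1 i
    have : ∑ i, ∑ j, F x i j = 0 := by
      rw [Finset.sum_comm]; exact Finset.sum_eq_zero fun j _ => h2 j
    rw [Fin.sum_univ_succ, Finset.sum_eq_zero fun i _ => h1 i] at this
    simpa using this
  · intro i j h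
    by_contra hc
    exact h (by simp [F, hc])
  · obtain ⟨⟨⟨i, j⟩, he⟩, h⟩ := Function.ne_iff.1 hx0
    exact ⟨i, j, by simpa [F, he] using h⟩

lemma exists_trade (m n : ℕ) (hm : 0 < m) (E : Finset (Fin m × Fin n))
    (hE : m + n - 1 < E.card) :
    ∃ A B : Fin m → Fin n → ℕ, (∀ i, ∑ j, A i j = ∑ j, B i j) ∧
      (∀ j, ∑ i, A i j = ∑ i, B i j) ∧ (∀ i j, A i j ≤ 1) ∧ (∀ i j, B i j ≤ 1) ∧
      (∀ i j, A i j ≠ 0 → (i, j) ∈ E) ∧ (∀ i j, B i j ≠ 0 → (i, j) ∈ E) ∧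
      (∀ i j, A i j ≠ 0 → B i j = 0) ∧ ∃ i j, A i j ≠ 0 := by
  classical
  obtain ⟨f, hr, hc, hs, i0, j0, h0⟩ := exists_kernel m n hm E hE
  let R := {i : Fin m // ∃ j, f i j ≠ 0}
  have : Nonempty R := ⟨⟨i0, j0, h0⟩⟩
  have hp : ∀ r : R, ∃ j, 0 < f r.1 j := by
    rintro ⟨i, j, h⟩
    obtain ⟨k, _, hk⟩ := Finset.exists_pos_of_sum_zero_of_exists_nonzero _ (hr i) ⟨j, Finset.mem_univ _, h⟩
    exact ⟨k, hk⟩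
  choose p hp using hp
  have hg : ∀ r : R, ∃ r' : R, f r'.1 (p r) < 0 := by
    intro r
    by_contra! hcon
    have : ∀ i, 0 ≤ f i (p r) := by
      intro i
      by_contra! hi
      exact absurd (hcon ⟨i, p r, hi.ne⟩) (not_le.2 hi)
    have h2 := (Finset.sum_eq_zero_iff_of_nonneg (fun i _ => this i)).1 (hc (p r)) r.1 (Finset.mem_univ _)
    exact (hp r).ne' h2
  choose g hg using hg
  let S : Finset R := Finset.univ.filter (· ∈ Function.periodicPts g)
  have hS : Set.BijOn g (S : Set R) (S : Set R) := by
    have : (S : Set R) = Function.periodicPts g := by ext; simp [S]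
    rw [this]; exact Function.bijOn_periodicPts g
  obtain ⟨r0, hr0⟩ := exists_periodic g
  have hr0S : r0 ∈ S := by simp [S, hr0]
  let A : Fin m → Fin n → ℕ := fun i j => ∑ r ∈ S, if r.1 = i ∧ p r = j then 1 else 0
  let B : Fin m → Fin n → ℕ := fun i j => ∑ r ∈ S, if (g r).1 = i ∧ p r = j then 1 else 0
  have hA : ∀ i j, A i j ≠ 0 → 0 < f i j := by
    intro i j h
    obtain ⟨r, _, h⟩ := Finset.exists_ne_zero_of_sum_ne_zero h
    have : r.1 = i ∧ p r = j := by by_contra hc; simp [hc] at h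
    rw [← this.1, ← this.2]; exact hp r
  have hB : ∀ i j, B i j ≠ 0 → f i j < 0 := by
    intro i j h
    obtain ⟨r, _, h⟩ := Finset.exists_ne_zero_of_sum_ne_zero h
    have : (g r).1 = i ∧ p r = j := by by_contra hc; simp [hc] at h
    rw [← this.1, ← this.2]; exact hg r
  refine ⟨A, B, ?_, ?_, ?_, ?_, fun i j h => hs i j (hA i j h).ne', fun i j h => hs i j (hB i j h).ne, ?_, r0.1, p r0, ?_⟩
  · intro i
    simp only [A, B]
    rw [Finset.sum_comm, Finset.sum_comm (s := Finset.univ)]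
    simp only [ite_and, Finset.sum_ite_irrel, Finset.sum_ite_eq, Finset.mem_univ, if_true,
      Finset.sum_const_zero]
    symm
    exact Finset.sum_nbij g hS.mapsTo hS.injOn hS.surjOn (fun _ _ => rfl)
  · intro j
    simp only [A, B]
    rw [Finset.sum_comm, Finset.sum_comm (s := Finset.univ)]
    refine Finset.sum_congr rfl fun r _ => ?_
    simp only [ite_and, Finset.sum_ite_eq, Finset.mem_univ, if_true]
  · intro i j
    simp only [A, Finset.sum_boole, Nat.cast_id]
    rw [Finset.card_le_one]
    intro a ha b hb
    simp only [Finset.mem_filter] at ha hb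
    exact Subtype.ext (ha.2.1.trans hb.2.1.symm)
  · intro i j
    simp only [B, Finset.sum_boole, Nat.cast_id]
    rw [Finset.card_le_one]
    intro a ha b hb
    simp only [Finset.mem_filter] at ha hb
    exact hS.injOn ha.1 hb.1 (Subtype.ext (ha.2.1.trans hb.2.1.symm))
  · intro i j h
    by_contra h'
    exact lt_asymm (hA i j h) (hB i j h')
  · simp only [A]
    intro h
    have := (Finset.sum_eq_zero_iff.1 h) r0 hr0S
    simp at this

lemma pair_bound (m n t : ℕ) (hm : 0 < m)
    (D : Fin m → Fin n → Multiset (Fin t)) (hD : IsDefiningSetRect m n t D)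
    (a b : Fin t) (hab : a ≠ b) :
    (Finset.univ.filter (fun x : Fin m × Fin n => a ∉ D x.1 x.2 ∧ b ∉ D x.1 x.2)).card
      ≤ m + n - 1 := by
  classical
  by_contra! hcon
  obtain ⟨A, B, hr, hc, hA1, hB1, hAE, hBE, hAB, i0, j0, h0⟩ := exists_trade m n hm _ hcon
  simp only [Finset.mem_filter, Finset.mem_univ, true_and] at hAE hBE
  let c : Fin m → Fin n → Fin t → ℕ := fun i j s =>
    if s = a then 1 + A i j - B i j else if s = b then 1 + B i j - A i j else 1
  let L : Fin m → Fin n → Multiset (Fin t) := fun i j => ∑ s, Multiset.replicate (c i j s) s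
  have hL : ∀ i j s, (L i j).count s = c i j s := by
    intro i j s
    simp [L, Multiset.count_sum', Multiset.count_replicate]
  have hbal : IsBalancedRect m n t L := by
    refine ⟨?_, ?_, ?_⟩
    · intro i j
      have h1 : (L i j).card = ∑ s, c i j s := by simp [L]
      rw [h1]
      have h2 : ∀ s, (c i j s : ℤ) = 1 + (if s = a then (A i j : ℤ) - B i j else 0)
          + (if s = b then (B i j : ℤ) - A i j else 0) := by
        intro s
        have := hA1 i j
        have := hB1 i j
        simp only [c]
        split_ifs with h h' <;> first | (exact absurd (h.symm.trans h') hab) | omega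
      zify
      simp only [h2, Finset.sum_add_distrib]
      simp
      ring
    · intro i s
      simp only [hL]
      have h2 : ∀ j, (c i j s : ℤ) = 1 + (if s = a then 1 else if s = b then -1 else 0) * ((A i j : ℤ) - B i j) := by
        intro j
        have := hA1 i j
        have := hB1 i j
        simp only [c]
        split_ifs <;> omega
      have h3 := hr i
      zify at h3 ⊢
      simp only [h2, Finset.sum_add_distrib, ← Finset.mul_sum, Finset.sum_sub_distrib, h3]
      simp
    · intro j s
      simp only [hL]
      have h2 : ∀ i, (c i j s : ℤ) = 1 + (if s = a then 1 else if s = b then -1 else 0) * ((A i j : ℤ) - B i j) := by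
        intro i
        have := hA1 i j
        have := hB1 i j
        simp only [c]
        split_ifs <;> omega
      have h3 := hc j
      zify at h3 ⊢
      simp only [h2, Finset.sum_add_distrib, ← Finset.mul_sum, Finset.sum_sub_distrib, h3]
      simp
  have hle : ∀ i j, D i j ≤ L i j := by
    intro i j
    rw [Multiset.le_iff_count]
    intro s
    rw [hL]
    have h1 : (D i j).count s ≤ 1 := 
      (Multiset.count_le_of_le s (hD.2.1 i j)).trans (Multiset.nodup_iff_count_le_one.1 Finset.univ.nodup s)
    by_cases hz : A i j = 0 ∧ B i j = 0
    · simp only [c, hz.1, hz.2]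
      split_ifs <;> omega
    · have : a ∉ D i j ∧ b ∉ D i j := by
        by_cases hA : A i j = 0
        · exact hBE i j (fun h => hz ⟨hA, h⟩)
        · exact hAE i j hA
      have h3 := Multiset.count_eq_zero.2 this.1
      have h4 := Multiset.count_eq_zero.2 this.2
      simp only [c]
      split_ifs with h h'
      · subst h; omega
      · subst h'; omega
      · exact h1
  have hEq := hD.2.2 L hbal hle
  have h5 : (L i0 j0).count a = 1 := by
    rw [hEq]
    exact Multiset.count_eq_one_of_mem Finset.univ.nodup (Finset.mem_univ a)
  rw [hL] at h5
  have := hAB i0 j0 h0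
  simp only [c, if_true] at h5
  omega

theorem sum_missing_pairs_le (m n t : ℕ) (hm : 0 < m) (hn : 0 < n) (ht : 2 ≤ t)
    (D : Fin m → Fin n → Multiset (Fin t)) (hD : IsDefiningSetRect m n t D)
    (e : Fin m → Fin n → ℕ) (he : ∀ i j, e i j = (D i j).card) :
    ∑ i : Fin m, ∑ j : Fin n, ((t : ℝ) - e i j) * ((t : ℝ) - e i j - 1) / 2 ≤
      (t : ℝ) * ((t : ℝ) - 1) * ((m : ℝ) + (n : ℝ) - 1) / 2 := by
  classical
  let M : Fin m × Fin n → Finset (Fin t) := fun x => Finset.univ.filter (fun s => s ∉ D x.1 x.2)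
  have hM : ∀ x, (M x).card + e x.1 x.2 = t := by
    intro x
    have hnd : (D x.1 x.2).Nodup := Multiset.nodup_of_le (hD.2.1 x.1 x.2) Finset.univ.nodup
    have h1 : e x.1 x.2 = (Finset.univ.filter (fun s => s ∈ D x.1 x.2)).card := by
      rw [he, ← Multiset.toFinset_card_of_nodup hnd]
      congr 1
      ext s; simp
    rw [h1, add_comm]
    have := Finset.card_filter_add_card_filter_not (s := (Finset.univ : Finset (Fin t))) (fun s => s ∈ D x.1 x.2)
    simpa [M] using this
  have hoff : ∀ s : Finset (Fin t), (s.offDiag.card : ℝ) = (s.card : ℝ) * (s.card - 1) := by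
    intro s
    rw [Finset.offDiag_card, Nat.cast_sub (Nat.le_mul_self _)]
    push_cast; ring
  have key : ∑ x, (M x).offDiag.card ≤ (Finset.univ : Finset (Fin t)).offDiag.card * (m + n - 1) := by
    have h1 : ∀ x, (M x).offDiag.card = ∑ y ∈ (Finset.univ : Finset (Fin t)).offDiag,
        if y.1 ∉ D x.1 x.2 ∧ y.2 ∉ D x.1 x.2 then 1 else 0 := by
      intro x
      rw [Finset.sum_boole, Nat.cast_id]
      congr 1
      ext y
      simp [M, Finset.mem_offDiag]
      tauto
    simp only [h1]
    rw [Finset.sum_comm, ← smul_eq_mul]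
    apply Finset.sum_le_card_nsmul
    intro y hy
    rw [Finset.sum_boole, Nat.cast_id]
    exact pair_bound m n t hm D hD y.1 y.2 (by simpa using hy)
  have key2 : ∑ x, ((M x).offDiag.card : ℝ) ≤ (t : ℝ) * (t - 1) * (m + n - 1) := by
    have h := (Nat.cast_le (α := ℝ)).2 key
    rw [Nat.cast_mul, hoff, Nat.cast_sub (by omega)] at h
    push_cast at h
    simpa using h
  rw [← Fintype.sum_prod_type' (fun i j => ((t : ℝ) - e i j) * ((t : ℝ) - e i j - 1) / 2), ← Finset.sum_div]
  refine div_le_div_of_nonneg_right ?_ (by norm_num)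
  refine le_trans (le_of_eq (Finset.sum_congr rfl fun x _ => ?_)) key2
  have h := hM x
  have h' : ((M x).card : ℝ) = t - e x.1 x.2 := by
    have h2 : (((M x).card + e x.1 x.2 : ℕ) : ℝ) = t := congrArg _ h
    push_cast at h2; linarith
  rw [hoff, h']
end

section
/- Let k ≥ 3, v ≥ k+1, let D be a defining set for the full design F(v,k), and let K ⊆ {1,…,v} be a fixed subset with |K| = k−3. Let d_K be the number of blocks of D which include K as a subset. Then d_K ≥ (v−k+3)(v−k+2)(v−k+1/2 − √((32(v−k)+11)/12))/6. -/
/-- The full design on point set `P` with block size `k`: all `k`-element subsets of `P`. -/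
def fullDesignOn {α : Type*} [DecidableEq α] (P : Finset α) (k : ℕ) : Finset (Finset α) :=
  P.powersetCard k

/-- A `(P, k, lam)`-design: a multiset of `k`-element subsets (blocks) of the point set `P`
such that every unordered pair of distinct points of `P` lies in exactly `lam` blocks
(repeated blocks are allowed). -/
def IsDesignOn {α : Type*} [DecidableEq α] (P : Finset α) (k lam : ℕ)
    (B : Multiset (Finset α)) : Prop :=
  (∀ b ∈ B, b ⊆ P ∧ b.card = k) ∧
  ∀ i ∈ P, ∀ j ∈ P, i ≠ j → Multiset.countP (fun b => i ∈ b ∧ j ∈ b) B = lam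

/-- `D` is a defining set for the full design on `P` with block size `k`: `D` is a set of
blocks of the full design, and the only `(P, k, C(|P|−2, k−2))`-design (repeated blocks
allowed) containing `D` is the full design. -/
def IsDefiningSetOn {α : Type*} [DecidableEq α] (P : Finset α) (k : ℕ)
    (D : Finset (Finset α)) : Prop :=
  D ⊆ fullDesignOn P k ∧
  ∀ B : Multiset (Finset α), IsDesignOn P k ((P.card - 2).choose (k - 2)) B →
    D.val ≤ B → B = (fullDesignOn P k).val

section
open SimpleGraph

noncomputable def altW {V : Type*} [DecidableEq V] {F : SimpleGraph V} :
    {u v : V} → F.Walk u v → Sym2 V → ℤ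
  | _, _, .nil, _ => 0
  | _, _, .cons (u := a) (v := b) _ p, g => (if g = s(a, b) then 1 else 0) - altW p g

noncomputable def sgnW {V : Type*} [DecidableEq V] (F : SimpleGraph V) (w : V) (g : Sym2 V) : ℤ :=
  (-1) ^ ((∑ a ∈ g.toFinset, F.dist w a) / 2)

lemma altW_concat {V : Type*} [DecidableEq V] {F : SimpleGraph V} {u v w : V} (p : F.Walk u v)
    (h : F.Adj v w) (g : Sym2 V) :
    altW (p.concat h) g = altW p g + (-1) ^ p.length * (if g = s(v, w) then 1 else 0) := by
  induction p with
  | nil => simp [Walk.concat, altW]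
  | cons h' p ih => 
    rw [Walk.concat_cons]
    simp only [altW, ih, Walk.length_cons, pow_succ]
    ring

lemma dist_eq_of_path {V : Type*} {F : SimpleGraph V} (hF : F.IsAcyclic) {u v : V}
    (p : F.Walk u v) (hp : p.IsPath) : F.dist u v = p.length := by
  obtain ⟨q, hq, hl⟩ := (p.reachable).exists_path_of_dist
  have := (hF.subsingleton_path u v).elim ⟨p, hp⟩ ⟨q, hq⟩
  have h2 : p = q := congrArg Subtype.val this
  rw [h2, hl]

lemma altW_eq {V : Type*} [DecidableEq V] {F : SimpleGraph V} (hF : F.IsAcyclic) {u v : V}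
    (p : F.Walk u v) (hp : p.IsPath) (g : Sym2 V) :
    altW p g = if g ∈ p.edges then sgnW F u g else 0 := by
  induction p using Walk.concatRec with
  | Hnil => simp [altW]
  | @Hconcat u v w p h ih =>
    have hpp := hp
    rw [Walk.concat_isPath_iff] at hp
    have d1 := dist_eq_of_path hF p hp.1
    have d2 := dist_eq_of_path hF _ hpp
    rw [Walk.length_concat] at d2
    rw [altW_concat, ih hp.1, Walk.edges_concat]
    have hne : s(v, w) ∉ p.edges := fun hm => hp.2 (p.snd_mem_support_of_mem_edges hm)
    by_cases hg : g = s(v, w)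
    · subst hg
      have : (∑ a ∈ (s(v, w) : Sym2 V).toFinset, F.dist u a) / 2 = p.length := by
        rw [Sym2.toFinset_mk_eq, Finset.sum_pair h.ne, d1, d2]; omega
      simp [hne, sgnW, this]
    · simp [hg]

lemma sum_ind {V : Type*} [Fintype V] [DecidableEq V] (a b y : V) (hab : a ≠ b) :
    ∑ g : Sym2 V, (if y ∈ g then (if g = s(a, b) then (1 : ℤ) else 0) else 0)
      = (if y = a then 1 else 0) + (if y = b then 1 else 0) := by
  rw [Finset.sum_eq_single s(a, b)]
  · by_cases h1 : y = a
    · subst h1; simp [hab]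
    · simp [h1]
  · intro g _ hg; simp [hg]
  · simp

lemma altW_sum {V : Type*} [Fintype V] [DecidableEq V] {F : SimpleGraph V} {u v : V}
    (p : F.Walk u v) (y : V) :
    ∑ g : Sym2 V, (if y ∈ g then altW p g else 0)
      = (if y = u then 1 else 0) - (-1) ^ p.length * (if y = v then 1 else 0) := by
  induction p with
  | nil => simp [altW]
  | @cons a b c h p ih =>
    have : ∀ g : Sym2 V, (if y ∈ g then altW (Walk.cons h p) g else 0) =
      (if y ∈ g then (if g = s(a, b) then (1 : ℤ) else 0) else 0) - 
      (if y ∈ g then altW p g else 0) := by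
      intro g; split_ifs <;> simp [altW, *]
    rw [Finset.sum_congr rfl (fun g _ => this g), Finset.sum_sub_distrib, ih, sum_ind _ _ _ h.ne]
    rw [Walk.length_cons, pow_succ]; ring

/-- no alternating vectors -/
def NoAlt {V : Type*} [Fintype V] [DecidableEq V] (G : SimpleGraph V) : Prop :=
  ∀ x : Sym2 V → ℤ, (∀ g, x g ≠ 0 → g ∈ G.edgeSet) → (∀ g, |x g| ≤ 1) →
    (∀ y, ∑ g, (if y ∈ g then x g else 0) = 0) → ∀ g, x g = 0

lemma sgnW_or {V : Type*} [DecidableEq V] (F : SimpleGraph V) (w : V) (g : Sym2 V) :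
    sgnW F w g = 1 ∨ sgnW F w g = -1 := neg_one_pow_eq_or ℤ _

lemma even_of_noAlt {V : Type*} [Fintype V] [DecidableEq V] {F G : SimpleGraph V}
    (hF : F.IsAcyclic) (hFG : F ≤ G) (hG : NoAlt G) {u v : V} (p : F.Walk u v) (hp : p.IsPath)
    (huv : G.Adj u v) (hn : ¬ F.Adj u v) : Even p.length := by
  by_contra ho
  rw [Nat.not_even_iff_odd] at ho
  have he : s(u, v) ∉ p.edges := fun h => hn (p.adj_of_mem_edges h)
  have h0 : altW p s(u, v) = 0 := by rw [altW_eq hF p hp, if_neg he]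
  have := hG (fun g => altW p g - (if g = s(u, v) then 1 else 0)) ?_ ?_ ?_ s(u, v)
  · simp [h0] at this
  · intro g hg
    by_cases h : g = s(u, v)
    · subst h; exact huv
    · simp only [h, if_false, altW_eq hF p hp] at hg
      have : g ∈ p.edges := by by_contra h; simp [h] at hg
      exact edgeSet_mono hFG (p.edges_subset_edgeSet this)
  · intro g
    by_cases h : g = s(u, v)
    · subst h; simp [h0]
    · simp only [h, if_false, altW_eq hF p hp]
      rcases sgnW_or F u g with h | h <;> split_ifs <;> simp [h]
  · intro y
    have : ∀ g : Sym2 V, (if y ∈ g then altW p g - (if g = s(u, v) then 1 else 0) else 0) =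
      (if y ∈ g then altW p g else 0) - 
      (if y ∈ g then (if g = s(u, v) then (1 : ℤ) else 0) else 0) := by
      intro g; split_ifs <;> simp 
    rw [Finset.sum_congr rfl (fun g _ => this g), Finset.sum_sub_distrib, altW_sum,
      sum_ind _ _ _ huv.ne, ho.neg_one_pow]
    ring

lemma rooted {V : Type*} [Fintype V] [DecidableEq V] {F : SimpleGraph V}
    (hF : F.IsAcyclic) {u v : V} (p : F.Walk u v) (hp : p.IsPath)
    (huv : u ≠ v) (hn : ¬ F.Adj u v) (hev : Even p.length) (w : V) (hw : w ∈ p.support) :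
    ∃ x : Sym2 V → ℤ, (∀ y, ∑ g, (if y ∈ g then x g else 0) = if y = w then 2 else 0) ∧
      (x s(u, v) = 1 ∨ x s(u, v) = -1) ∧
      ∀ g, g ≠ s(u, v) → x g = 0 ∨ (g ∈ F.edgeSet ∧ x g = sgnW F w g) := by
  set p1 := (p.takeUntil w hw).reverse with hp1
  set p2 := p.dropUntil w hw with hp2
  have i1 : p1.IsPath := (hp.takeUntil hw).reverse
  have i2 : p2.IsPath := hp.dropUntil hw
  have hdis : ∀ g, g ∈ p1.edges → g ∈ p2.edges → False := by
    intro g h1 h2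
    rw [hp1, Walk.edges_reverse, List.mem_reverse] at h1
    exact hp.isTrail.disjoint_edges_takeUntil_dropUntil hw h1 h2
  have hlen : p1.length + p2.length = p.length := by
    have := congrArg Walk.length (p.take_spec hw)
    rw [Walk.length_append] at this
    rw [hp1, Walk.length_reverse]; exact this
  have hpar : ((-1 : ℤ)) ^ p1.length = (-1) ^ p2.length := by
    rw [← hlen, Nat.even_add] at hev
    by_cases h : Even p1.length
    · rw [h.neg_one_pow, (hev.1 h).neg_one_pow]
    · rw [(Nat.not_even_iff_odd.1 h).neg_one_pow,
        (Nat.not_even_iff_odd.1 (fun h' => h (hev.2 h'))).neg_one_pow]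
  have n1 : s(u, v) ∉ p1.edges := fun h => hn (p1.adj_of_mem_edges h)
  have n2 : s(u, v) ∉ p2.edges := fun h => hn (p2.adj_of_mem_edges h)
  refine ⟨fun g => altW p1 g + altW p2 g + (-1) ^ p1.length * (if g = s(u, v) then 1 else 0),
    ?_, ?_, ?_⟩
  · intro y
    have : ∀ g : Sym2 V, (if y ∈ g then altW p1 g + altW p2 g +
        (-1) ^ p1.length * (if g = s(u, v) then 1 else 0) else 0) =
      (if y ∈ g then altW p1 g else 0) + (if y ∈ g then altW p2 g else 0) +
      (-1) ^ p1.length * (if y ∈ g then (if g = s(u, v) then (1 : ℤ) else 0) else 0) := by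
      intro g; split_ifs <;> simp 
    rw [Finset.sum_congr rfl (fun g _ => this g), Finset.sum_add_distrib, Finset.sum_add_distrib,
      ← Finset.mul_sum, altW_sum, altW_sum, sum_ind _ _ _ huv, ← hpar]
    have : (if y = w then (2 : ℤ) else 0) = 2 * (if y = w then 1 else 0) := by split_ifs <;> simp
    rw [this]; ring
  · simp only [altW_eq hF _ i1, altW_eq hF _ i2, if_neg n1, if_neg n2]
    simpa using neg_one_pow_eq_or ℤ p1.length
  · intro g hg
    simp only [altW_eq hF _ i1, altW_eq hF _ i2, if_neg hg]
    by_cases h1 : g ∈ p1.edges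
    · have h2 : g ∉ p2.edges := fun h => hdis g h1 h
      right; exact ⟨p1.edges_subset_edgeSet h1, by simp [h1, h2]⟩
    · by_cases h2 : g ∈ p2.edges
      · right; exact ⟨p2.edges_subset_edgeSet h2, by simp [h1, h2]⟩
      · left; simp [h1, h2]

lemma disj_of_noAlt {V : Type*} [Fintype V] [DecidableEq V] {F G : SimpleGraph V}
    (hF : F.IsAcyclic) (hFG : F ≤ G) (hG : NoAlt G)
    {u v : V} (p : F.Walk u v) (hp : p.IsPath) (huv : G.Adj u v) (hn : ¬ F.Adj u v)
    {u' v' : V} (p' : F.Walk u' v') (hp' : p'.IsPath) (huv' : G.Adj u' v') (hn' : ¬ F.Adj u' v')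
    (hne : s(u, v) ≠ s(u', v')) (w : V) (hw : w ∈ p.support) (hw' : w ∈ p'.support) : False := by
  obtain ⟨x, x1, x2, x3⟩ := rooted hF p hp huv.ne hn (even_of_noAlt hF hFG hG p hp huv hn) w hw
  obtain ⟨z, z1, z2, z3⟩ :=
    rooted hF p' hp' huv'.ne hn' (even_of_noAlt hF hFG hG p' hp' huv' hn') w hw'
  have ze : z s(u, v) = 0 := by
    rcases z3 _ hne with h | h
    · exact h
    · exact absurd h.1 hn
  have xe : x s(u', v') = 0 := by
    rcases x3 _ hne.symm with h | h
    · exact h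
    · exact absurd h.1 hn'
  have := hG (fun g => x g - z g) ?_ ?_ ?_ s(u, v)
  · simp only [ze] at this
    omega
  · intro g hg
    by_cases h1 : g = s(u, v)
    · subst h1; exact huv
    by_cases h2 : g = s(u', v')
    · subst h2; exact huv'
    rcases x3 g h1 with h | h
    · rcases z3 g h2 with h' | h'
      · simp [h, h'] at hg
      · exact edgeSet_mono hFG h'.1
    · exact edgeSet_mono hFG h.1
  · intro g
    by_cases h1 : g = s(u, v)
    · subst h1; rcases x2 with h | h <;> simp [h, ze]
    by_cases h2 : g = s(u', v')
    · subst h2; rcases z2 with h | h <;> simp [h, xe]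
    rcases x3 g h1 with h | h <;> rcases z3 g h2 with h' | h' <;> 
      rcases sgnW_or F w g with hs | hs <;> simp [h, h', hs]
  · intro y
    have : ∀ g : Sym2 V, (if y ∈ g then x g - z g else 0) =
      (if y ∈ g then x g else 0) - (if y ∈ g then z g else 0) := by
      intro g; split_ifs <;> simp 
    rw [Finset.sum_congr rfl (fun g _ => this g), Finset.sum_sub_distrib, x1, z1, sub_self]

lemma acyclic_card {V : Type*} [Fintype V] [Nonempty V] (F : SimpleGraph V) (hF : F.IsAcyclic)
    [Fintype F.edgeSet] : F.edgeFinset.card + 1 ≤ Fintype.card V := by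
  classical
  obtain ⟨T, hFT, -, hT⟩ := (connected_top (V := V)).exists_isTree_le_of_le_of_isAcyclic le_top hF
  rw [← hT.card_edgeFinset]
  exact Nat.add_le_add_right (Finset.card_le_card (edgeFinset_mono hFT)) 1

lemma edges_bound {V : Type*} [Fintype V] [DecidableEq V] [Nonempty V] (G : SimpleGraph V)
    [Fintype G.edgeSet] (hG : NoAlt G) : 3 * G.edgeFinset.card + 3 ≤ 4 * Fintype.card V := by
  classical
  obtain ⟨F, hFG, hF, hr⟩ := G.exists_isAcyclic_reachable_eq_le
  have hc := acyclic_card F hF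
  set N := G.edgeFinset \ F.edgeFinset with hN
  have hcard : N.card + F.edgeFinset.card = G.edgeFinset.card := by
    rw [hN]; exact Finset.card_sdiff_add_card_eq_card (edgeFinset_mono hFG)
  have key : ∀ e ∈ N, ∃ S : Finset V, ∃ u v, ∃ p : F.Walk u v, p.IsPath ∧ e = s(u, v) ∧
      S = p.support.toFinset ∧ G.Adj u v ∧ ¬ F.Adj u v := by
    intro e he
    induction e with
    | _ u v =>
    simp only [hN, Finset.mem_sdiff, mem_edgeFinset, mem_edgeSet] at he
    have : F.Reachable u v := by rw [hr]; exact he.1.reachable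
    obtain ⟨p, hp⟩ := this.exists_isPath
    exact ⟨_, u, v, p, hp, rfl, rfl, he.1, he.2⟩
  choose! S hS using key
  have h3 : ∀ e ∈ N, 3 ≤ (S e).card := by
    intro e he
    obtain ⟨u, v, p, hp, rfl, hs, a, b⟩ := hS e he
    rw [hs, List.toFinset_card_of_nodup hp.support_nodup, Walk.length_support]
    have h1 := even_of_noAlt hF hFG hG p hp a b
    have h2 : p.length ≠ 0 := fun h => a.ne (Walk.eq_of_length_eq_zero h)
    obtain ⟨r, hr⟩ := h1
    omega
  have hd : Set.PairwiseDisjoint (N : Set (Sym2 V)) S := by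
    intro e he f hf hef
    obtain ⟨u, v, p, hp, rfl, hs, a, b⟩ := hS e he
    obtain ⟨u', v', p', hp', rfl, hs', a', b'⟩ := hS f hf
    simp only [Function.onFun]
    rw [hs, hs', Finset.disjoint_left]
    intro w hw hw'
    exact disj_of_noAlt hF hFG hG p hp a b p' hp' a' b' hef w (by simpa using hw) (by simpa using hw')
  have h4 : N.card * 3 ≤ Fintype.card V := by
    calc N.card * 3 ≤ ∑ e ∈ N, (S e).card := by
          rw [← smul_eq_mul]; exact Finset.card_nsmul_le_sum _ _ _ h3
      _ = (N.biUnion S).card := (Finset.card_biUnion hd).symm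
      _ ≤ _ := Finset.card_le_univ _
  omega

end

open Finset in
lemma count_pair {α : Type*} [Fintype α] [DecidableEq α] (k : ℕ) (hk : 2 ≤ k) (i j : α)
    (hij : i ≠ j) :
    ((powersetCard k (univ : Finset α)).filter (fun b => i ∈ b ∧ j ∈ b)).card
      = ((univ : Finset α).card - 2).choose (k - 2) := by
  have h2 : (univ \ {i, j} : Finset α).card = (univ : Finset α).card - 2 := by
    rw [card_sdiff_of_subset (subset_univ _), card_pair hij]
  rw [← h2, ← card_powersetCard]
  refine card_bij' (fun b _ => b \ {i, j}) (fun b _ => b ∪ {i, j}) ?_ ?_ ?_ ?_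
  · intro b hb
    simp only [mem_filter, mem_powersetCard] at hb ⊢
    refine ⟨sdiff_subset_sdiff (subset_univ _) le_rfl, ?_⟩
    rw [card_sdiff_of_subset (by intro x; simp; rintro (rfl | rfl) <;> tauto), card_pair hij, hb.1.2]
  · intro b hb
    simp only [mem_filter, mem_powersetCard] at hb ⊢
    refine ⟨⟨subset_univ _, ?_⟩, by simp, by simp⟩
    rw [card_union_of_disjoint, card_pair hij, hb.2]
    · omega
    · exact disjoint_of_subset_left hb.1 sdiff_disjoint
  · intro b hb
    simp only [mem_filter, mem_powersetCard] at hb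
    exact sdiff_union_of_subset (by intro x; simp; rintro (rfl | rfl) <;> tauto)
  · intro b hb
    simp only [mem_powersetCard] at hb
    exact union_sdiff_cancel_right (disjoint_of_subset_left hb.1 sdiff_disjoint)

def blkW {α : Type*} [DecidableEq α] (K : Finset α) {P : α → Prop} (q : α) (e : Sym2 (Subtype P)) :
    Finset α := insert q (K ∪ e.toFinset.map (Function.Embedding.subtype P))

lemma mem_blkW {α : Type*} [DecidableEq α] (K : Finset α) {P : α → Prop} (q : α)
    (e : Sym2 (Subtype P)) (j : α) :
    j ∈ blkW K q e ↔ j = q ∨ j ∈ K ∨ ∃ h : P j, (⟨j, h⟩ : Subtype P) ∈ e := by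
  simp [blkW]

lemma blkW_inj {α : Type*} [DecidableEq α] (K : Finset α) {P : α → Prop} (q : α)
    (hP : ∀ x, P x → x ∉ K ∧ x ≠ q) (e e' : Sym2 (Subtype P)) (h : blkW K q e = blkW K q e') :
    e = e' := by
  apply Sym2.ext
  intro ⟨x, hx⟩
  have := congrArg (x ∈ ·) h
  simp only [mem_blkW, (hP x hx).1, (hP x hx).2, hx, false_or, exists_true_left] at this
  exact iff_of_eq this

lemma blkW_card {α : Type*} [DecidableEq α] (K : Finset α) {P : α → Prop} (q : α) (hq : q ∉ K)
    (hP : ∀ x, P x → x ∉ K ∧ x ≠ q) (e : Sym2 (Subtype P)) (h : ¬ e.IsDiag) :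
    (blkW K q e).card = K.card + 3 := by
  rw [blkW, Finset.card_insert_of_notMem, Finset.card_union_of_disjoint, Finset.card_map,
    Sym2.card_toFinset_of_not_isDiag _ h]
  · rw [Finset.disjoint_right]
    simp only [Finset.mem_map]
    rintro _ ⟨⟨x, hx⟩, -, rfl⟩
    exact (hP x hx).1
  · simp only [Finset.mem_union, Finset.mem_map, hq, false_or]
    rintro ⟨⟨x, hx⟩, -, h⟩
    exact (hP x hx).2 h

lemma sum_zero {V : Type*} [Fintype V] [DecidableEq V] (x : Sym2 V → ℤ)
    (h1 : ∀ e, x e ≠ 0 → ¬ e.IsDiag) (h2 : ∀ y, ∑ g, (if y ∈ g then x g else 0) = 0) :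
    ∑ g, x g = 0 := by
  have : ∑ y : V, ∑ g : Sym2 V, (if y ∈ g then x g else 0) = 2 * ∑ g, x g := by
    rw [Finset.sum_comm, Finset.mul_sum]
    refine Finset.sum_congr rfl fun g _ => ?_
    by_cases hx : x g = 0
    · simp [hx]
    · have : (Finset.univ.filter (fun y => y ∈ g)) = g.toFinset := by ext; simp
      rw [← Finset.sum_filter, this, Finset.sum_const, Sym2.card_toFinset_of_not_isDiag _ (h1 g hx)]
      simp
  simp only [h2, Finset.sum_const_zero] at this
  omega

lemma sum_blk {α : Type*} [Fintype α] [DecidableEq α] (K : Finset α) {P : α → Prop}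
    [Fintype (Subtype P)] (q j : α) (hj : j ≠ q) (x : Sym2 (Subtype P) → ℤ)
    (hP : ∀ x, P x → x ∉ K ∧ x ≠ q)
    (h1 : ∀ e, x e ≠ 0 → ¬ e.IsDiag) (h2 : ∀ y, ∑ g, (if y ∈ g then x g else 0) = 0) :
    ∑ e, (if j ∈ blkW K q e then x e else 0) = 0 := by
  by_cases hK : j ∈ K
  · simp [mem_blkW, hK, sum_zero x h1 h2]
  · by_cases hp : P j
    · simpa [mem_blkW, hK, hj, hp] using h2 ⟨j, hp⟩
    · simp [mem_blkW, hK, hj, hp]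

open Finset in
lemma trade {α : Type*} [Fintype α] [DecidableEq α] (k : ℕ) (hk : 3 ≤ k)
    (D : Finset (Finset α)) (hD : IsDefiningSetOn (Finset.univ : Finset α) k D)
    (K : Finset α) (hK : K.card = k - 3) {P : α → Prop} [Fintype (Subtype P)]
    (c d : α) (hcd : c ≠ d) (hc : c ∉ K) (hd : d ∉ K)
    (hP : ∀ x, P x → x ∉ K ∧ x ≠ c ∧ x ≠ d)
    (x : Sym2 (Subtype P) → ℤ)
    (h1 : ∀ e, x e ≠ 0 → ¬ e.IsDiag ∧ blkW K c e ∉ D ∧ blkW K d e ∉ D)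
    (habs : ∀ e, |x e| ≤ 1)
    (h2 : ∀ y, ∑ g, (if y ∈ g then x g else 0) = 0) : ∀ e, x e = 0 := by
  have hPc : ∀ x, P x → x ∉ K ∧ x ≠ c := fun x h => ⟨(hP x h).1, (hP x h).2.1⟩
  have hPd : ∀ x, P x → x ∉ K ∧ x ≠ d := fun x h => ⟨(hP x h).1, (hP x h).2.2⟩
  have hdg : ∀ e, x e ≠ 0 → ¬ e.IsDiag := fun e h => (h1 e h).1
  have dnc : ∀ e : Sym2 (Subtype P), d ∉ blkW K c e := by
    intro e h; rw [mem_blkW] at h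
    rcases h with h | h | ⟨h, -⟩
    · exact hcd h.symm
    · exact hd h
    · exact (hP d h).2.2 rfl
  have cnd : ∀ e : Sym2 (Subtype P), c ∉ blkW K d e := by
    intro e h; rw [mem_blkW] at h
    rcases h with h | h | ⟨h, -⟩
    · exact hcd h
    · exact hc h
    · exact (hP c h).2.1 rfl
  have cc : ∀ e : Sym2 (Subtype P), c ∈ blkW K c e := by intro e; simp [mem_blkW]
  have dd : ∀ e : Sym2 (Subtype P), d ∈ blkW K d e := by intro e; simp [mem_blkW]
  set f : Finset α → ℤ := fun b => ∑ e, ((if b = blkW K c e then x e else 0) -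
    (if b = blkW K d e then x e else 0)) with hf
  have fc : ∀ e, f (blkW K c e) = x e := by
    intro e
    simp only [hf]
    rw [sum_eq_single e]
    · have : blkW K c e ≠ blkW K d e := fun h => cnd e (h ▸ cc e)
      simp [this]
    · intro e' _ hne
      have h1 : blkW K c e ≠ blkW K d e' := fun h => cnd e' (h ▸ cc e)
      have h2 : blkW K c e ≠ blkW K c e' := fun h => hne (blkW_inj K c hPc _ _ h).symm
      simp [h1, h2]
    · simp
  have fd : ∀ e, f (blkW K d e) = - x e := by
    intro e
    simp only [hf]
    rw [sum_eq_single e]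
    · have : blkW K d e ≠ blkW K c e := fun h => cnd e (h ▸ cc e)
      simp [this]
    · intro e' _ hne
      have h1 : blkW K d e ≠ blkW K c e' := fun h => dnc e' (h ▸ dd e)
      have h2 : blkW K d e ≠ blkW K d e' := fun h => hne (blkW_inj K d hPd _ _ h).symm
      simp [h1, h2]
    · simp
  have f0 : ∀ b, (∀ e : Sym2 (Subtype P), b ≠ blkW K c e) → (∀ e : Sym2 (Subtype P), b ≠ blkW K d e) → f b = 0 := by
    intro b hb hb'
    simp [hf, hb, hb']
  have fge : ∀ b, 0 ≤ 1 + f b := by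
    intro b
    by_cases hb : ∃ e : Sym2 (Subtype P), b = blkW K c e
    · obtain ⟨e, rfl⟩ := hb
      rw [fc]; have := abs_le.1 (habs e); omega
    by_cases hb' : ∃ e : Sym2 (Subtype P), b = blkW K d e
    · obtain ⟨e, rfl⟩ := hb'
      rw [fd]; have := abs_le.1 (habs e); omega
    push Not at hb hb'
    rw [f0 b hb hb']; norm_num
  have fD : ∀ b ∈ D, f b = 0 := by
    intro b hbD
    by_cases hb : ∃ e : Sym2 (Subtype P), b = blkW K c e
    · obtain ⟨e, rfl⟩ := hb
      rw [fc]; by_contra h; exact (h1 e h).2.1 hbD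
    by_cases hb' : ∃ e : Sym2 (Subtype P), b = blkW K d e
    · obtain ⟨e, rfl⟩ := hb'
      rw [fd]; by_contra h; exact (h1 e (by simpa using h)).2.2 hbD
    push Not at hb hb'
    exact f0 b hb hb'
  set Q := powersetCard k (univ : Finset α) with hQ
  have memc : ∀ e, x e ≠ 0 → blkW K c e ∈ Q := by
    intro e he
    rw [hQ, mem_powersetCard]
    refine ⟨subset_univ _, ?_⟩
    rw [blkW_card K c hc hPc e (hdg e he), hK]; omega
  have memd : ∀ e, x e ≠ 0 → blkW K d e ∈ Q := by
    intro e he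
    rw [hQ, mem_powersetCard]
    refine ⟨subset_univ _, ?_⟩
    rw [blkW_card K d hd hPd e (hdg e he), hK]; omega
  set B : Multiset (Finset α) := ∑ b ∈ Q, Multiset.replicate (1 + f b).toNat b with hB
  have cB : ∀ b ∈ Q, B.count b = (1 + f b).toNat := by
    intro b hb
    rw [hB, Multiset.count_sum', sum_eq_single b]
    · simp
    · intro b' _ hne; rw [Multiset.count_replicate, if_neg hne]
    · exact fun h => absurd hb h
  have hdes : IsDesignOn (univ : Finset α) k (((univ : Finset α).card - 2).choose (k - 2)) B := by
    constructor
    · intro b hb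
      rw [hB, Multiset.mem_sum] at hb
      obtain ⟨b', hb', h⟩ := hb
      rw [Multiset.eq_of_mem_replicate h]
      exact mem_powersetCard.1 hb'
    · intro i _ j _ hij
      have e1 : Multiset.countP (fun b => i ∈ b ∧ j ∈ b) B =
          ∑ b ∈ Q, if i ∈ b ∧ j ∈ b then (1 + f b).toNat else 0 := by
        rw [hB, ← Multiset.coe_countPAddMonoidHom, map_sum]
        refine sum_congr rfl fun b _ => ?_
        rw [Multiset.coe_countPAddMonoidHom]
        split_ifs with h
        · rw [Multiset.countP_eq_card.2, Multiset.card_replicate]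
          intro a ha; rw [Multiset.eq_of_mem_replicate ha]; exact h
        · rw [Multiset.countP_eq_zero]
          intro a ha; rw [Multiset.eq_of_mem_replicate ha]; exact h
      have e2 : ∑ b ∈ Q, (if i ∈ b ∧ j ∈ b then f b else 0) = 
          ∑ e, ((if i ∈ blkW K c e ∧ j ∈ blkW K c e then x e else 0) -
            (if i ∈ blkW K d e ∧ j ∈ blkW K d e then x e else 0)) := by
        have : ∀ b, (if i ∈ b ∧ j ∈ b then f b else 0) = ∑ e, 
            ((if b = blkW K c e then (if i ∈ b ∧ j ∈ b then x e else 0) else 0) -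
             (if b = blkW K d e then (if i ∈ b ∧ j ∈ b then x e else 0) else 0)) := by
          intro b; split_ifs
          · rfl
          · simp
        rw [sum_congr rfl (fun b _ => this b), sum_comm]
        refine sum_congr rfl fun e _ => ?_
        by_cases hx : x e = 0
        · simp [hx]
        · rw [sum_sub_distrib, sum_ite_eq', sum_ite_eq', if_pos (memc e hx), if_pos (memd e hx)]
      have e3 : ∑ e, ((if i ∈ blkW K c e ∧ j ∈ blkW K c e then x e else 0) -
            (if i ∈ blkW K d e ∧ j ∈ blkW K d e then x e else 0)) = 0 := by
        by_cases hic : i = c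
        · subst hic
          simpa [cc, cnd] using sum_blk K i j hij.symm x hPc hdg h2
        by_cases hjc : j = c
        · subst hjc
          simpa [cc, cnd] using sum_blk K j i hij x hPc hdg h2
        by_cases hid : i = d
        · subst hid
          simpa [dd, dnc] using sum_blk K i j hij.symm x hPd hdg h2
        by_cases hjd : j = d
        · subst hjd
          simpa [dd, dnc] using sum_blk K j i hij x hPd hdg h2
        · refine sum_eq_zero fun e _ => ?_
          have h3 : i ∈ blkW K c e ↔ i ∈ blkW K d e := by simp only [mem_blkW, hic, hid]
          have h4 : j ∈ blkW K c e ↔ j ∈ blkW K d e := by simp only [mem_blkW, hjc, hjd]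
          simp only [h3, h4, sub_self]
      rw [← count_pair k (by omega) i j hij, e1]
      zify
      rw [card_filter]
      push_cast
      rw [← sub_eq_zero, ← sum_sub_distrib, ← e3, ← e2]
      refine sum_congr rfl fun b _ => ?_
      split_ifs
      · rw [Int.toNat_of_nonneg (fge b)]; ring
      · simp
  have hDB : D.val ≤ B := by
    rw [Multiset.le_iff_count]
    intro b
    by_cases hb : b ∈ D
    · rw [cB b (hD.1 hb), fD b hb]
      simpa using Multiset.nodup_iff_count_le_one.1 D.nodup b
    · rw [Multiset.count_eq_zero_of_notMem (by simpa using hb)]; exact Nat.zero_le _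
  have hBQ := hD.2 B hdes hDB
  intro e
  by_contra hx
  have h5 := cB _ (memc e hx)
  rw [hBQ, fc] at h5
  have h6 : Multiset.count (blkW K c e) (fullDesignOn univ k).val = 1 :=
    Multiset.count_eq_one_of_mem (fullDesignOn univ k).nodup (memc e hx)
  rw [h6] at h5
  omega

lemma sum_sub_type {α : Type*} [Fintype α] {P : α → Prop} [Fintype (Subtype P)] (g : α → ℤ)
    (h : ∀ a, g a ≠ 0 → P a) : ∑ a, g a = ∑ a : Subtype P, g a := by
  classical
  rw [← Finset.sum_subtype (Finset.univ.filter P) (by simp) g, Finset.sum_filter_of_ne]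
  intro a _ ha; exact h a ha

open Finset in
lemma triW {α : Type*} [Fintype α] [DecidableEq α] (S : Finset α) :
    ∑ a : α, ∑ b : α, ∑ c : α,
      (if a ∈ S ∧ b ∈ S ∧ c ∈ S ∧ a ≠ b ∧ a ≠ c ∧ b ≠ c then (1 : ℤ) else 0)
      = (S.card : ℤ) * (S.card - 1) * (S.card - 2) := by
  have e1 : ∀ a b : α, ∑ c : α,
      (if a ∈ S ∧ b ∈ S ∧ c ∈ S ∧ a ≠ b ∧ a ≠ c ∧ b ≠ c then (1 : ℤ) else 0) =
      if (a, b) ∈ S.offDiag then ((S.card : ℤ) - 2) else 0 := by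
    intro a b
    simp only [mem_offDiag]
    split_ifs with h
    · have : (univ.filter (fun c => a ∈ S ∧ b ∈ S ∧ c ∈ S ∧ a ≠ b ∧ a ≠ c ∧ b ≠ c))
        = S \ {a, b} := by
        ext c; simp; grind
      rw [sum_boole, this, card_sdiff_of_subset (by intro x; simp; rintro (rfl | rfl) <;> tauto),
        card_pair h.2.2]
      have : 2 ≤ S.card := by
        rw [← card_pair h.2.2]; exact card_le_card (by intro x; simp; rintro (rfl | rfl) <;> tauto)
      push_cast [this]; rfl
    · apply sum_eq_zero
      intro c _
      rw [if_neg]; tauto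
  simp_rw [e1]
  rw [← Fintype.sum_prod_type' (f := fun a b => if (a, b) ∈ S.offDiag then ((S.card : ℤ) - 2) else 0)]
  rw [sum_ite_mem, univ_inter, sum_const, offDiag_card]
  have : S.card ≤ S.card * S.card := Nat.le_mul_self _
  simp only [nsmul_eq_mul]
  push_cast [this]; ring

open Finset in
lemma six_dK {α : Type*} [Fintype α] [DecidableEq α] (k : ℕ) (hk : 3 ≤ k)
    (D : Finset (Finset α)) (hD : D ⊆ powersetCard k univ)
    (K : Finset α) (hK : K.card = k - 3) :
    ∑ a : α, ∑ b : α, ∑ c : α, (if a ∈ Kᶜ ∧ b ∈ Kᶜ ∧ c ∈ Kᶜ ∧ a ≠ b ∧ a ≠ c ∧ b ≠ c then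
      (if insert c (insert a (insert b K)) ∈ D then (1 : ℤ) else 0) else 0)
      = 6 * ((D.filter (fun b => K ⊆ b)).card : ℤ) := by
  have e1 : ∀ a b c : α, (if a ∈ Kᶜ ∧ b ∈ Kᶜ ∧ c ∈ Kᶜ ∧ a ≠ b ∧ a ≠ c ∧ b ≠ c then
      (if insert c (insert a (insert b K)) ∈ D then (1 : ℤ) else 0) else 0) =
      ∑ t ∈ D.filter (fun b => K ⊆ b),
        if a ∈ t \ K ∧ b ∈ t \ K ∧ c ∈ t \ K ∧ a ≠ b ∧ a ≠ c ∧ b ≠ c then (1 : ℤ) else 0 := by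
    intro a b c
    by_cases h : a ∈ Kᶜ ∧ b ∈ Kᶜ ∧ c ∈ Kᶜ ∧ a ≠ b ∧ a ≠ c ∧ b ≠ c
    · rw [if_pos h]
      obtain ⟨ha, hb, hc, hab, hac, hbc⟩ := h
      rw [mem_compl] at ha hb hc
      have hKs : K ⊆ insert c (insert a (insert b K)) := by
        intro x hx; simp [hx]
      have hcard : (insert c (insert a (insert b K))).card = k := by
        rw [card_insert_of_notMem (by simp [hc, hac.symm, hbc.symm]),
          card_insert_of_notMem (by simp [ha, hab]), card_insert_of_notMem hb, hK]; omega
      have : ∀ t ∈ D.filter (fun b => K ⊆ b), 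
        (if a ∈ t \ K ∧ b ∈ t \ K ∧ c ∈ t \ K ∧ a ≠ b ∧ a ≠ c ∧ b ≠ c then (1 : ℤ) else 0) =
        if insert c (insert a (insert b K)) = t then 1 else 0 := by
        intro t ht
        rw [mem_filter] at ht
        have htc := (mem_powersetCard.1 (hD ht.1)).2
        congr 1
        apply propext
        constructor
        · rintro ⟨h1, h2, h3, -⟩
          apply eq_of_subset_of_card_le
          · simp only [mem_sdiff] at h1 h2 h3
            simp only [insert_subset_iff]
            exact ⟨h3.1, h1.1, h2.1, ht.2⟩
          · rw [hcard, htc]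
        · rintro rfl
          simp [ha, hb, hc, hab, hac, hbc]
      rw [sum_congr rfl this, sum_ite_eq]
      simp [mem_filter, hKs]
    · rw [if_neg h]
      symm
      apply sum_eq_zero
      intro t _
      rw [if_neg]
      simp only [mem_sdiff, mem_compl] at h ⊢
      tauto
  simp_rw [e1]
  have e2 : ∀ t ∈ D.filter (fun b => K ⊆ b), ∑ a : α, ∑ b : α, ∑ c : α,
        (if a ∈ t \ K ∧ b ∈ t \ K ∧ c ∈ t \ K ∧ a ≠ b ∧ a ≠ c ∧ b ≠ c then (1 : ℤ) else 0) = 6 := by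
    intro t ht
    rw [mem_filter] at ht
    have htc := (mem_powersetCard.1 (hD ht.1)).2
    have : (t \ K).card = 3 := by rw [card_sdiff_of_subset ht.2, htc, hK]; omega
    rw [triW, this]; norm_num
  have e3 : ∀ g : α → α → α → Finset α → ℤ, 
      ∑ a, ∑ b, ∑ c, ∑ t ∈ D.filter (fun b => K ⊆ b), g a b c t =
      ∑ t ∈ D.filter (fun b => K ⊆ b), ∑ a, ∑ b, ∑ c, g a b c t := by
    intro g
    rw [sum_comm]
    simp_rw [sum_comm (s := D.filter (fun b => K ⊆ b))]
    rw [sum_comm]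
  rw [e3, sum_congr rfl e2]
  simp [mul_comm]

noncomputable def tauW {α : Type*} [Fintype α] [DecidableEq α] (D : Finset (Finset α)) (K : Finset α)
    (a b c : α) : ℤ :=
  if a ∈ Kᶜ ∧ b ∈ Kᶜ ∧ c ∈ Kᶜ ∧ a ≠ b ∧ a ≠ c ∧ b ≠ c then
      (if insert c (insert a (insert b K)) ∈ D then (0 : ℤ) else 1) else 0

lemma tauW_ne {α : Type*} [Fintype α] [DecidableEq α] (D : Finset (Finset α)) (K : Finset α)
    (a b c : α) (h : tauW D K a b c ≠ 0) : 
    (a ∉ K ∧ b ∉ K ∧ c ∉ K ∧ a ≠ b ∧ a ≠ c ∧ b ≠ c) ∧ insert c (insert a (insert b K)) ∉ D := by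
  unfold tauW at h
  simp only [Finset.mem_compl] at h
  split_ifs at h <;> simp_all

lemma blkW_mk {α : Type*} [DecidableEq α] (K : Finset α) {P : α → Prop} (q : α)
    (a b : Subtype P) : blkW K q s(a, b) = insert q (insert a.1 (insert b.1 K)) := by
  ext j
  simp only [mem_blkW, Finset.mem_insert, Sym2.mem_iff, Subtype.ext_iff]
  have ha := a.2
  have hb := b.2
  constructor
  · rintro (h | h | ⟨_, h | h⟩) <;> tauto
  · rintro (h | h | h | h)
    · exact Or.inl h
    · exact Or.inr (Or.inr ⟨h ▸ ha, Or.inl h⟩)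
    · exact Or.inr (Or.inr ⟨h ▸ hb, Or.inr h⟩)
    · exact Or.inr (Or.inl h)

open Finset in
lemma W_bound {α : Type*} [Fintype α] [DecidableEq α] (k : ℕ) (hk : 3 ≤ k)
    (D : Finset (Finset α)) (hD : IsDefiningSetOn (Finset.univ : Finset α) k D)
    (K : Finset α) (hK : K.card = k - 3) (hn : 3 ≤ Kᶜ.card)
    (c d : α) (hcd : c ≠ d) (hc : c ∉ K) (hd : d ∉ K) :
    3 * ∑ a, ∑ b, tauW D K a b c * tauW D K a b d ≤ 8 * (Kᶜ.card : ℤ) - 22 := by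
  classical
  set P : α → Prop := fun x => x ∉ K ∧ x ≠ c ∧ x ≠ d with hPdef
  have hP : ∀ x, P x → x ∉ K ∧ x ≠ c ∧ x ≠ d := fun x h => h
  have hcardV : Fintype.card (Subtype P) = Kᶜ.card - 2 := by
    rw [Fintype.card_of_subtype (Kᶜ \ {c, d}) (by intro x; simp [hPdef]),
      card_sdiff_of_subset (by intro x; simp; rintro (rfl | rfl) <;> tauto), card_pair hcd]
  have hne : Nonempty (Subtype P) := by
    rw [← Fintype.card_pos_iff, hcardV]; omega
  let G : SimpleGraph (Subtype P) :=
    { Adj := fun a b => a ≠ b ∧ blkW K c s(a, b) ∉ D ∧ blkW K d s(a, b) ∉ D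
      symm := ⟨fun a b h => by rw [Sym2.eq_swap]; exact ⟨h.1.symm, h.2⟩⟩
      loopless := ⟨fun a h => h.1 rfl⟩ }
  have hno : NoAlt G := by
    intro x h1 h2 h3
    refine trade k hk D hD K hK c d hcd hc hd hP x ?_ h2 h3
    intro e he
    have := h1 e he
    induction e with
    | _ a b =>
      have h : G.Adj a b := this
      exact ⟨by simpa using h.1, h.2⟩
  have hb := edges_bound G hno
  have hW : ∑ a, ∑ b, tauW D K a b c * tauW D K a b d = 2 * (G.edgeFinset.card : ℤ) := by
    have := G.sum_degrees_eq_twice_card_edges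
    rw [← Nat.cast_ofNat, ← Nat.cast_mul, ← this]
    push_cast
    rw [sum_sub_type (P := P)]
    · refine sum_congr rfl fun a _ => ?_
      rw [sum_sub_type (P := P)]
      · rw [← G.card_neighborFinset_eq_degree, G.neighborFinset_eq_filter, card_filter]
        push_cast
        refine sum_congr rfl fun b _ => ?_
        have ha := a.2
        have hb := b.2
        have hab : a ≠ b ↔ a.1 ≠ b.1 := by rw [Ne, Subtype.ext_iff]
        simp only [hPdef] at ha hb
        simp only [G, blkW_mk, tauW, mem_compl, hab]
        by_cases h : a.1 = b.1
        · simp [h]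
        · simp [h, ha, hb, hc, hd]
          split_ifs <;> simp_all
      · intro b hb
        have h1 := tauW_ne _ _ _ _ _ (left_ne_zero_of_mul hb)
        have h2 := tauW_ne _ _ _ _ _ (right_ne_zero_of_mul hb)
        exact ⟨by tauto, by tauto, by tauto⟩
    · intro a ha
      obtain ⟨b, -, hb⟩ := exists_ne_zero_of_sum_ne_zero ha
      have h1 := tauW_ne _ _ _ _ _ (left_ne_zero_of_mul hb)
      have h2 := tauW_ne _ _ _ _ _ (right_ne_zero_of_mul hb)
      exact ⟨by tauto, by tauto, by tauto⟩
  rw [hW]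
  omega

open Finset in
lemma main_ineq {α : Type*} [Fintype α] [DecidableEq α] (k : ℕ) (hk : 3 ≤ k)
    (D : Finset (Finset α)) (hD : IsDefiningSetOn (Finset.univ : Finset α) k D)
    (K : Finset α) (hK : K.card = k - 3) (n : ℕ) (hn : 3 ≤ n) (hKn : Kᶜ.card = n)
    (X : ℤ) (hX : X = ∑ a, ∑ b, ∑ c, tauW D K a b c) :
    3 * X ^ 2 ≤ ((n : ℤ) * (n - 1)) * (3 * X + (n * (n - 1)) * (8 * n - 22)) := by
  have hoff : ((Kᶜ.offDiag.card : ℕ) : ℤ) = (n : ℤ) * (n - 1) := by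
    rw [offDiag_card, hKn]
    have : n ≤ n * n := Nat.le_mul_self _
    push_cast [this]; ring
  have hcs : X ^ 2 ≤ (n : ℤ) * (n - 1) * ∑ a, ∑ b, (∑ c, tauW D K a b c) ^ 2 := by
    have e1 : ∀ g : α → α → ℤ, (∀ a b, g a b ≠ 0 → (a, b) ∈ Kᶜ.offDiag) →
        ∑ a, ∑ b, g a b = ∑ q ∈ Kᶜ.offDiag, g q.1 q.2 := by
      intro g hg
      rw [← Fintype.sum_prod_type' (f := g)]
      symm
      apply sum_subset (subset_univ _)
      intro q _ hq
      by_contra h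
      exact hq (hg _ _ h)
    have hz : ∀ a b, ∑ c, tauW D K a b c ≠ 0 → (a, b) ∈ Kᶜ.offDiag := by
      intro a b h
      obtain ⟨c, -, hc⟩ := exists_ne_zero_of_sum_ne_zero h
      have := (tauW_ne _ _ _ _ _ hc).1
      simp only [mem_offDiag, mem_compl]; tauto
    rw [hX, e1 _ hz, e1 _ (fun a b h => hz a b (by intro h0; simp [h0] at h)), ← hoff]
    exact sq_sum_le_card_mul_sum_sq
  have hsq : ∑ a, ∑ b, (∑ c, tauW D K a b c) ^ 2 =
      ∑ c, ∑ d, ∑ a, ∑ b, tauW D K a b c * tauW D K a b d := by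
    simp_rw [sq, sum_mul_sum]
    calc _ = ∑ a, ∑ c, ∑ b, ∑ d, tauW D K a b c * tauW D K a b d :=
          sum_congr rfl fun a _ => sum_comm
      _ = ∑ c, ∑ a, ∑ b, ∑ d, tauW D K a b c * tauW D K a b d := sum_comm
      _ = ∑ c, ∑ a, ∑ d, ∑ b, tauW D K a b c * tauW D K a b d :=
          sum_congr rfl fun c _ => sum_congr rfl fun a _ => sum_comm
      _ = _ := sum_congr rfl fun c _ => sum_comm
  have hcd : ∀ c d : α, 3 * (∑ a, ∑ b, tauW D K a b c * tauW D K a b d) ≤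
      (if c = d then 3 * ∑ a, ∑ b, tauW D K a b c else 0) +
      (if (c, d) ∈ Kᶜ.offDiag then 8 * (n : ℤ) - 22 else 0) := by
    intro c d
    by_cases h : c = d
    · subst h
      have : ∀ a b, tauW D K a b c * tauW D K a b c = tauW D K a b c := by
        intro a b; unfold tauW; split_ifs <;> simp
      simp [this]
    · by_cases hm : c ∉ K ∧ d ∉ K
      · have := W_bound k hk D hD K hK (by omega) c d h hm.1 hm.2
        rw [hKn] at this
        simpa [h, hm.1, hm.2] using this
      · have : ∑ a, ∑ b, tauW D K a b c * tauW D K a b d = 0 := by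
          refine sum_eq_zero fun a _ => sum_eq_zero fun b _ => ?_
          by_contra hb
          have h1 := tauW_ne _ _ _ _ _ (left_ne_zero_of_mul hb)
          have h2 := tauW_ne _ _ _ _ _ (right_ne_zero_of_mul hb)
          tauto
        rw [this, if_neg h, if_neg (by simp only [mem_offDiag, mem_compl]; tauto)]
        simp
  have hS : 3 * ∑ a, ∑ b, (∑ c, tauW D K a b c) ^ 2 ≤
      3 * X + (n * (n - 1)) * (8 * n - 22) := by
    rw [hsq, mul_sum]
    simp_rw [mul_sum (s := univ) (a := (3 : ℤ)) (f := fun d => ∑ a, ∑ b, tauW D K a b _ * tauW D K a b d)]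
    refine (sum_le_sum fun c _ => sum_le_sum fun d _ => hcd c d).trans ?_
    simp_rw [sum_add_distrib]
    rw [← Fintype.sum_prod_type' (f := fun a b => if (a, b) ∈ Kᶜ.offDiag then 8 * (n : ℤ) - 22 else 0)]
    rw [sum_ite_mem, univ_inter, sum_const, nsmul_eq_mul, hoff]
    simp only [sum_ite_eq, mem_univ, if_true]
    rw [← mul_sum]
    have : ∑ c, ∑ a, ∑ b, tauW D K a b c = X := by
      rw [hX, sum_comm]
      exact sum_congr rfl fun a _ => sum_comm
    rw [this]
  have hp : (0 : ℤ) ≤ (n : ℤ) * (n - 1) := by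
    rw [← hoff]; positivity
  nlinarith [mul_le_mul_of_nonneg_left hS hp]

/-- Let `k ≥ 3`, `v ≥ k+1`, let `D` be a defining set for the full design `F(v,k)` and let
`K ⊆ {1,…,v}` with `|K| = k−3`. If `d_K` is the number of blocks of `D` containing `K`,
then `d_K ≥ (v−k+3)(v−k+2)(v−k+1/2 − √((32(v−k)+11)/12))/6`. -/
theorem blocks_through_K_lower_bound (v k : ℕ) (hk : 3 ≤ k) (hv : k + 1 ≤ v)
    (D : Finset (Finset (Fin v)))
    (hD : IsDefiningSetOn (Finset.univ : Finset (Fin v)) k D)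
    (K : Finset (Fin v)) (hK : K.card = k - 3) :
    ((D.filter (fun b => K ⊆ b)).card : ℝ) ≥
      ((v : ℝ) - k + 3) * ((v : ℝ) - k + 2) *
        ((v : ℝ) - k + 1 / 2 - Real.sqrt ((32 * ((v : ℝ) - k) + 11) / 12)) / 6 := by
  obtain ⟨w, rfl⟩ := Nat.exists_eq_add_of_le hv
  set n := w + 4 with hn
  have hKn : Kᶜ.card = n := by
    rw [Finset.card_compl, Fintype.card_fin, hK]; omega
  set δ := (D.filter (fun b => K ⊆ b)).card with hδ
  have h6 := six_dK k hk D hD.1 K hK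
  have ht := triW Kᶜ
  have hX : (n : ℤ) * (n - 1) * (n - 2) - 6 * (δ : ℤ) = ∑ a, ∑ b, ∑ c, tauW D K a b c := by
    rw [hδ, ← h6, ← hKn, ← ht]
    simp only [← Finset.sum_sub_distrib]
    refine Finset.sum_congr rfl fun a _ => Finset.sum_congr rfl fun b _ =>
      Finset.sum_congr rfl fun c _ => ?_
    unfold tauW
    split_ifs <;> simp
  have hm := main_ineq k hk D hD K hK n (by omega) hKn _ hX
  have hm' : 3 * ((n : ℝ) * (n - 1) * (n - 2) - 6 * δ) ^ 2 ≤ ((n : ℝ) * (n - 1)) *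
      (3 * ((n : ℝ) * (n - 1) * (n - 2) - 6 * δ) + (n * (n - 1)) * (8 * n - 22)) := by
    exact_mod_cast hm
  have hvk : ((k + 1 + w : ℕ) : ℝ) - k = n - 3 := by rw [hn]; push_cast; ring
  rw [hvk]
  have hn4 : (4 : ℝ) ≤ n := by rw [hn]; push_cast; linarith [(Nat.cast_nonneg w : (0 : ℝ) ≤ w)]
  generalize (δ : ℝ) = y at *
  generalize (n : ℝ) = N at *
  have hp : 0 < N * (N - 1) := by nlinarith
  set p := N * (N - 1) with hpd
  obtain ⟨z, hz⟩ : ∃ z, p * (N - 2) - 6 * y = p * z :=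
    ⟨(p * (N - 2) - 6 * y) / p, by field_simp⟩
  rw [hz] at hm'
  have hz2 : 3 * z ^ 2 ≤ 3 * z + (8 * N - 22) := by
    have : 0 < p ^ 2 := by positivity
    by_contra hlt
    push Not at hlt
    nlinarith [mul_lt_mul_of_pos_left hlt this]
  have hs : |z - 1 / 2| ≤ Real.sqrt ((32 * (N - 3) + 11) / 12) := by
    apply Real.abs_le_sqrt
    nlinarith
  have hs' := (abs_le.1 hs).2
  set s := Real.sqrt ((32 * (N - 3) + 11) / 12)
  have h7 : (N - 3 + 3) * (N - 3 + 2) = p := by rw [hpd]; ring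
  rw [h7, ge_iff_le, div_le_iff₀ (by norm_num)]
  nlinarith [mul_le_mul_of_nonneg_left hs' hp.le]
end
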